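/- arXiv:2104.03810 — 2 statements merged into one kernel-verified Lean document; each statement's English description precedes it below -/
import Mathlib

section
/- A random element Y = (Y_i)_{i∈ℤ^d} of ℝ₀^{ℤ^d} is exceedance-stationary if and only if it satisfies the tail-process identity, i.e. E[h(θ_k Y) 1{|Y_k| > 1}] = E[h(Y) 1{|Y_{−k}| > 1}] for every measurable h : ℝ^{ℤ^d} → [0,∞) and every k ∈ ℤ^d. (In particular, tail processes of stationary random fields are exceedance-stationary.) -/
open MeasureTheory ENNReal Filter ProbabilityTheory

noncomputable section

/-- The space `ℝ^{ℤ^d}` of real-valued fields indexed by `ℤ^d`. -/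
abbrev RField (d : ℕ) := (Fin d → ℤ) → ℝ

variable {d : ℕ}

/-- Shift operator: `shift k x = (x_{i+k})_i`, i.e. it moves the origin to `k`. -/
def shift (k : Fin d → ℤ) (x : RField d) : RField d := fun i => x (i + k)

/-- The set of exceedance-points of `x`. -/
def excSet (x : RField d) : Set (Fin d → ℤ) := {k | 1 < |x k|}

open Classical in
/-- Indicator (with values in `ℝ≥0∞`) of the event that `|x k| > s`. -/
def exIndGT (s : ℝ) (k : Fin d → ℤ) (x : RField d) : ℝ≥0∞ := if s < |x k| then 1 else 0

/-- The tail-process identity: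
`E[h(θ_k Y) 1{|Y_k| > 1}] = E[h(Y) 1{|Y_{−k}| > 1}]` for every measurable nonnegative `h`
and every `k ∈ ℤ^d`. -/
def TailIdentity {Ω : Type*} [MeasurableSpace Ω] (μ : Measure Ω) (Y : Ω → RField d) : Prop :=
  ∀ h : RField d → ℝ≥0∞, Measurable h → ∀ k : Fin d → ℤ,
    ∫⁻ ω, h (shift k (Y ω)) * exIndGT 1 k (Y ω) ∂μ
      = ∫⁻ ω, h (Y ω) * exIndGT 1 (-k) (Y ω) ∂μ

/-- `Y` is exceedance-stationary: for every exceedance-map `τ` which is bijective on a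
measurable set `B` (invariant under shifting the origin to exceedance-points, contained in
`ℝ₀^{ℤ^d}`) carrying the law of `Y`, we have `θ_τ Y ≐ Y`. -/
def ExcStationary {Ω : Type*} [MeasurableSpace Ω] (μ : Measure Ω) (Y : Ω → RField d) : Prop :=
  ∀ (B : Set (RField d)) (τ : RField d → Fin d → ℤ),
    MeasurableSet B → Measurable τ →
    (∀ x ∈ B, 1 < |x 0|) →
    (∀ x ∈ B, ∀ k ∈ excSet x, shift k x ∈ B) →
    (∀ x ∈ B, τ x ∈ excSet x) →
    (∀ x ∈ B, Set.BijOn (fun k => k + τ (shift k x)) (excSet x) (excSet x)) →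
    (∀ᵐ ω ∂μ, Y ω ∈ B) →
    Measure.map (fun ω => shift (τ (Y ω)) (Y ω)) μ = Measure.map Y μ

/-- `E₀`: elements of `ℝ₀^{ℤ^d}` with finitely many exceedance-points. -/
def E0set (d : ℕ) : Set (RField d) := {x | 1 < |x 0| ∧ (excSet x).Finite}

/-- `E`: elements of `ℝ^{ℤ^d}` with at least one but finitely many exceedance-points. -/
def Eset (d : ℕ) : Set (RField d) := {x | (excSet x).Nonempty ∧ (excSet x).Finite}

/-- `l₀`: fields vanishing at infinity. -/
def l0set (d : ℕ) : Set (RField d) := {x | Tendsto (fun i => |x i|) cofinite (nhds 0)}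

/-- Uniform norm `‖x‖ = sup_i |x_i|`. -/
def supNorm (x : RField d) : ℝ := ⨆ i, |x i|

/-- `V` is Pareto(α)-distributed: `P(V > y) = y^{-α}` for `y ≥ 1`. -/
def IsPareto {Ω : Type*} [MeasurableSpace Ω] (μ : Measure Ω) (V : Ω → ℝ) (α : ℝ) : Prop :=
  ∀ y : ℝ, 1 ≤ y → μ {ω | y < V ω} = ENNReal.ofReal (y ^ (-α))

/-- An anchoring function on `S`: a measurable shift-covariant exceedance-map. -/
def IsAnchoringOn (S : Set (RField d)) (A : RField d → Fin d → ℤ) : Prop :=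
  Measurable A ∧ ∀ x ∈ S, A x ∈ excSet x ∧ ∀ k ∈ excSet x, A (shift k x) + k = A x

/-- `h` is shift-invariant on `S`. -/
def ShiftInvariantOn (S : Set (RField d)) (h : RField d → ℝ≥0∞) : Prop :=
  ∀ x ∈ S, ∀ k : Fin d → ℤ, h (shift k x) = h x

lemma shift_apply (k i : Fin d → ℤ) (x : RField d) : shift k x i = x (i + k) := rfl

lemma shift_zero (x : RField d) : shift 0 x = x := by
  funext i; simp [shift_apply]

lemma one_lt_abs_shift_zero {k : Fin d → ℤ} {x : RField d} (hk : k ∈ excSet x) :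
    1 < |shift k x 0| := by
  rw [shift_apply, zero_add]
  exact hk

lemma shift_shift (j k : Fin d → ℤ) (x : RField d) : shift j (shift k x) = shift (j + k) x := by
  funext i; simp [shift_apply, add_assoc]

lemma shift_neg_shift (k : Fin d → ℤ) (x : RField d) : shift (-k) (shift k x) = x := by
  rw [shift_shift, neg_add_cancel, shift_zero]

lemma shift_shift_neg (k : Fin d → ℤ) (x : RField d) : shift k (shift (-k) x) = x := by
  rw [shift_shift, add_neg_cancel, shift_zero]

lemma measurable_shift (k : Fin d → ℤ) : Measurable (shift k : RField d → RField d) :=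
  measurable_pi_lambda _ fun i => measurable_pi_apply (i + k)

/-- Shifting by a measurable random vector is measurable. -/
lemma measurable_shift_comp {τ : RField d → Fin d → ℤ} (hτ : Measurable τ) :
    Measurable fun x => shift (τ x) x := by
  have h : Measurable fun p : (Fin d → ℤ) × RField d => shift p.1 p.2 :=
    measurable_from_prod_countable_right fun k => measurable_shift k
  exact h.comp (hτ.prodMk measurable_id)

lemma measurableSet_exceed (k : Fin d → ℤ) : MeasurableSet {x : RField d | 1 < |x k|} :=
  measurableSet_lt measurable_const (continuous_abs.measurable.comp (measurable_pi_apply k))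

lemma exIndGT_eq_indicator (k : Fin d → ℤ) (x : RField d) :
    exIndGT 1 k x = {x : RField d | 1 < |x k|}.indicator 1 x := by
  by_cases h : 1 < |x k| <;> simp [exIndGT, h]

lemma measurable_exIndGT (k : Fin d → ℤ) : Measurable (exIndGT 1 k : RField d → ℝ≥0∞) := by
  rw [funext (exIndGT_eq_indicator k)]
  exact measurable_one.indicator (measurableSet_exceed k)

/-- The tail-process identity implies exceedance-stationarity, by decomposing along the value of
the exceedance-map. -/
lemma TailIdentity.excStationary {Ω : Type*} [MeasurableSpace Ω] {μ : Measure Ω}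
    {Y : Ω → RField d} (hY : Measurable Y) (hT : TailIdentity μ Y) : ExcStationary μ Y := by
  classical
  intro B τ _ hτ hB0 _ hτe hbij hYB
  ext C hC
  have hS : Measurable fun ω => shift (τ (Y ω)) (Y ω) := (measurable_shift_comp hτ).comp hY
  let D : (Fin d → ℤ) → Set (RField d) := fun k => C ∩ {y | τ (shift (-k) y) = k}
  have hD : ∀ k, MeasurableSet (D k) := fun k =>
    hC.inter ((hτ.comp (measurable_shift (-k))) (measurableSet_singleton k))
  let h : (Fin d → ℤ) → RField d → ℝ≥0∞ := fun k => (D k).indicator 1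
  have hh : ∀ k, Measurable (h k) := fun k => measurable_one.indicator (hD k)
  have hleft : ∀ x ∈ B, C.indicator (1 : RField d → ℝ≥0∞) (shift (τ x) x)
      = ∑' k, h k (shift k x) * exIndGT 1 k x := by
    intro x hx
    rw [tsum_eq_single (τ x)]
    · have : 1 < |x (τ x)| := hτe x hx
      simp [h, D, exIndGT, this, Set.indicator_apply, shift_neg_shift]
    · intro k hk
      simp [h, D, shift_neg_shift, hk.symm]
  have hright : ∀ x ∈ B, C.indicator (1 : RField d → ℝ≥0∞) x
      = ∑' k, h k x * exIndGT 1 (-k) x := by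
    intro x hx
    obtain ⟨j, hj, hj0⟩ := (hbij x hx).surjOn (show (0 : Fin d → ℤ) ∈ excSet x from hB0 x hx)
    have hτj : τ (shift j x) = -j := eq_neg_of_add_eq_zero_right hj0
    rw [tsum_eq_single (-j)]
    · have : 1 < |x j| := hj
      simp [h, D, exIndGT, this, Set.indicator_apply, hτj]
    · intro k hk
      by_cases hke : 1 < |x (-k)|
      · have hne : τ (shift (-k) x) ≠ k := by
          intro he
          refine hk ?_
          have := (hbij x hx).injOn (show -k ∈ excSet x from hke) hj
            (by simp only [he, hτj]; simp)
          rw [← this, neg_neg]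
        simp [h, D, hne]
      · simp [exIndGT, hke]
  rw [Measure.map_apply hS hC, Measure.map_apply hY hC,
    ← lintegral_indicator_one (hS hC), ← lintegral_indicator_one (hY hC)]
  calc ∫⁻ ω, ((fun ω => shift (τ (Y ω)) (Y ω)) ⁻¹' C).indicator 1 ω ∂μ
      = ∫⁻ ω, ∑' k, h k (shift k (Y ω)) * exIndGT 1 k (Y ω) ∂μ :=
        lintegral_congr_ae (hYB.mono fun ω hω => hleft _ hω)
    _ = ∑' k, ∫⁻ ω, h k (shift k (Y ω)) * exIndGT 1 k (Y ω) ∂μ :=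
        lintegral_tsum fun k => ((((hh k).comp (measurable_shift k)).mul
          (measurable_exIndGT k)).comp hY).aemeasurable
    _ = ∑' k, ∫⁻ ω, h k (Y ω) * exIndGT 1 (-k) (Y ω) ∂μ := tsum_congr fun k => hT _ (hh k) k
    _ = ∫⁻ ω, ∑' k, h k (Y ω) * exIndGT 1 (-k) (Y ω) ∂μ :=
        (lintegral_tsum fun k =>
          (((hh k).mul (measurable_exIndGT (-k))).comp hY).aemeasurable).symm
    _ = ∫⁻ ω, (Y ⁻¹' C).indicator 1 ω ∂μ :=
        lintegral_congr_ae (hYB.mono fun ω hω => (hright _ hω).symm)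

open Classical in
/-- The exceedance-map exchanging the exceedance-points `j` and `j + k` whenever the field seen
from `j` lies in `A`. -/
def swapMap (A : Set (RField d)) (k : Fin d → ℤ) (x : RField d) : Fin d → ℤ :=
  if x ∈ A ∧ 1 < |x k| then k else if shift (-k) x ∈ A ∧ 1 < |x (-k)| then -k else 0

lemma measurable_swapMap {A : Set (RField d)} (hA : MeasurableSet A) (k : Fin d → ℤ) :
    Measurable (swapMap A k) :=
  Measurable.ite (hA.inter (measurableSet_exceed k)) measurable_const <|
    Measurable.ite ((measurable_shift (-k) hA).inter (measurableSet_exceed (-k)))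
      measurable_const measurable_const

lemma swapMap_mem_excSet (A : Set (RField d)) (k : Fin d → ℤ) {x : RField d} (hx : 1 < |x 0|) :
    swapMap A k x ∈ excSet x := by
  unfold swapMap
  split_ifs with h₁ h₂
  exacts [h₁.2, h₂.2, hx]

lemma swapMap_shift_swapMap {A : Set (RField d)} {k : Fin d → ℤ}
    (hAk : ∀ x ∈ A, shift k x ∉ A) {x : RField d} (hx : 1 < |x 0|) :
    swapMap A k (shift (swapMap A k x) x) = -swapMap A k x := by
  by_cases h₁ : x ∈ A ∧ 1 < |x k|
  · simp [swapMap, h₁, hAk x h₁.1, shift_neg_shift, shift_apply, hx]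
  · by_cases h₂ : shift (-k) x ∈ A ∧ 1 < |x (-k)|
    · simp [swapMap, h₁, h₂, shift_apply, hx]
    · simp [swapMap, h₁, h₂, shift_zero]

lemma bijOn_swapMap {A : Set (RField d)} {k : Fin d → ℤ}
    (hAk : ∀ x ∈ A, shift k x ∉ A) (x : RField d) :
    Set.BijOn (fun j => j + swapMap A k (shift j x)) (excSet x) (excSet x) := by
  have hzero : ∀ j ∈ excSet x, 1 < |shift j x 0| := fun j hj =>
    one_lt_abs_shift_zero hj
  have hmaps : Set.MapsTo (fun j => j + swapMap A k (shift j x)) (excSet x) (excSet x) := by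
    intro j hj
    have := swapMap_mem_excSet A k (hzero j hj)
    simpa only [excSet, Set.mem_ofPred_eq, shift_apply, add_comm] using this
  have hinv : Set.LeftInvOn (fun j => j + swapMap A k (shift j x))
      (fun j => j + swapMap A k (shift j x)) (excSet x) := by
    intro j hj
    have := swapMap_shift_swapMap hAk (hzero j hj)
    rw [shift_shift, add_comm] at this
    simp only [this, add_neg_cancel_right]
  exact Set.InvOn.bijOn ⟨hinv, hinv⟩ hmaps hmaps

lemma shift_swapMap_mem_iff {A C : Set (RField d)} {k : Fin d → ℤ}
    (hAk : ∀ x ∈ A, shift k x ∉ A) {x : RField d} (hx : 1 < |x 0|) :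
    shift (swapMap A k x) x ∈ C ∩ {y | shift (-k) y ∈ A} ∩ {y | 1 < |y (-k)|} ↔
      (shift k x ∈ C ∧ x ∈ A) ∧ 1 < |x k| := by
  by_cases h₁ : x ∈ A ∧ 1 < |x k|
  · simp [swapMap, h₁, shift_neg_shift, shift_apply, hx]
  · by_cases h₂ : shift (-k) x ∈ A ∧ 1 < |x (-k)|
    · have h₃ : shift (-k) (shift (-k) x) ∉ A := fun h =>
        hAk _ h (by rw [shift_shift_neg]; exact h₂.1)
      simp only [swapMap, h₁, h₂]
      simp only [if_false, and_self, if_true]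
      constructor
      · exact fun h => absurd h.1.2 h₃
      · exact fun h => absurd ⟨h.1.2, h.2⟩ h₁
    · simp only [swapMap, h₁, h₂, if_false, shift_zero]
      constructor
      · exact fun h => absurd ⟨h.1.2, h.2⟩ h₂
      · exact fun h => absurd ⟨h.1.2, h.2⟩ h₁

/-- Exceedance-stationarity, applied to `swapMap A k`, gives the tail-process identity for events
under which the field seen from `-k` lies in `A`. -/
lemma ExcStationary.measure_eq {Ω : Type*} [MeasurableSpace Ω] {μ : Measure Ω}
    {Y : Ω → RField d} (hY : Measurable Y) (hY0 : ∀ᵐ ω ∂μ, 1 < |Y ω 0|)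
    (hE : ExcStationary μ Y) {A C : Set (RField d)} {k : Fin d → ℤ} (hA : MeasurableSet A)
    (hAk : ∀ x ∈ A, shift k x ∉ A) (hC : MeasurableSet C) :
    μ {ω | (shift k (Y ω) ∈ C ∧ Y ω ∈ A) ∧ 1 < |Y ω k|}
      = μ {ω | (Y ω ∈ C ∧ shift (-k) (Y ω) ∈ A) ∧ 1 < |Y ω (-k)|} := by
  have hmap := hE {x | 1 < |x 0|} (swapMap A k) (measurableSet_exceed 0)
    (measurable_swapMap hA k) (fun _ hx => hx)
    (fun _ _ _ hj => one_lt_abs_shift_zero hj)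
    (fun x hx => swapMap_mem_excSet A k hx) (fun x _ => bijOn_swapMap hAk x) hY0
  have hD : MeasurableSet (C ∩ {y : RField d | shift (-k) y ∈ A} ∩ {y | 1 < |y (-k)|}) :=
    (hC.inter (measurable_shift (-k) hA)).inter (measurableSet_exceed (-k))
  have hS : Measurable fun ω => shift (swapMap A k (Y ω)) (Y ω) :=
    (measurable_shift_comp (measurable_swapMap hA k)).comp hY
  have := congrArg (fun ν => ν (C ∩ {y | shift (-k) y ∈ A} ∩ {y | 1 < |y (-k)|})) hmap
  rw [Measure.map_apply hS hD, Measure.map_apply hY hD] at this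
  exact (measure_congr <| eventuallyEq_set.2 <|
    hY0.mono fun ω hω => (shift_swapMap_mem_iff hAk hω).symm).trans this

/-- The fields not fixed by `shift k` are covered by countably many measurable sets disjoint from
their image under `shift k`. -/
lemma exists_countable_cover_shift_ne (k : Fin d → ℤ) :
    ∃ A : TopologicalSpace.countableBasis (RField d) → Set (RField d),
      (∀ n, MeasurableSet (A n)) ∧ (∀ n, ∀ x ∈ A n, shift k x ∉ A n) ∧
        ∀ x, shift k x ≠ x → ∃ n, x ∈ A n := by
  have hb := TopologicalSpace.isBasis_countableBasis (RField d)
  refine ⟨fun u => {x | x ∈ (u : Set (RField d)) ∧ shift k x ∉ (u : Set (RField d))},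
    fun u => ?_, fun u x hx hx' => hx.2 hx'.1, fun x hx => ?_⟩
  · have hu := (hb.isOpen u.2).measurableSet
    exact hu.inter (measurable_shift k hu).compl
  · obtain ⟨u, hu, hxu, hsub⟩ := hb.exists_subset_of_mem_open
      (show x ∈ ({shift k x}ᶜ : Set (RField d)) from fun h => hx h.symm)
      isOpen_compl_singleton
    exact ⟨⟨u, hu⟩, hxu, fun h => hsub h rfl⟩

lemma ExcStationary.tailIdentity {Ω : Type*} [MeasurableSpace Ω] {μ : Measure Ω}
    {Y : Ω → RField d} (hY : Measurable Y) (hY0 : ∀ᵐ ω ∂μ, 1 < |Y ω 0|)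
    (hE : ExcStationary μ Y) : TailIdentity μ Y := by
  intro h hh k
  have hYk : Measurable fun ω => shift k (Y ω) := (measurable_shift k).comp hY
  obtain ⟨A, hAm, hAk, hAcov⟩ := exists_countable_cover_shift_ne k
  have hU : ∀ j, MeasurableSet {ω | 1 < |Y ω j|} := fun j => hY (measurableSet_exceed j)
  have hmain : (μ.restrict {ω | 1 < |Y ω k|}).map (fun ω => shift k (Y ω))
      = (μ.restrict {ω | 1 < |Y ω (-k)|}).map Y := by
    let S : Option (TopologicalSpace.countableBasis (RField d)) → Set (RField d) :=
      fun o => o.elim {y | shift (-k) y = y} fun n => {y | shift (-k) y ∈ A n}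
    have hS : ⋃ o, S o = Set.univ := by
      refine Set.eq_univ_of_forall fun y => Set.mem_iUnion.2 ?_
      by_cases hy : shift (-k) y = y
      · exact ⟨none, hy⟩
      · obtain ⟨n, hn⟩ := hAcov (shift (-k) y) (by rw [shift_shift_neg]; exact fun e => hy e.symm)
        exact ⟨some n, hn⟩
    have : Countable (TopologicalSpace.countableBasis (RField d)) :=
      (TopologicalSpace.countable_countableBasis (RField d)).to_subtype
    have hSm : ∀ o, MeasurableSet (S o) := by
      rintro (_ | n)
      · exact measurableSet_eq_fun (measurable_shift (-k)) measurable_id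
      · exact measurable_shift (-k) (hAm n)
    rw [Measure.ext_iff_of_iUnion_eq_univ hS]
    intro o
    ext C hC
    rw [Measure.restrict_apply hC, Measure.restrict_apply hC,
      Measure.map_apply hYk (hC.inter (hSm o)), Measure.map_apply hY (hC.inter (hSm o)),
      Measure.restrict_apply (hYk (hC.inter (hSm o))),
      Measure.restrict_apply (hY (hC.inter (hSm o)))]
    rcases o with _ | n
    · refine measure_congr (hY0.mono fun ω hω => propext ?_)
      change (shift k (Y ω) ∈ C ∧ shift (-k) (shift k (Y ω)) = shift k (Y ω)) ∧ 1 < |Y ω k| ↔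
        (Y ω ∈ C ∧ shift (-k) (Y ω) = Y ω) ∧ 1 < |Y ω (-k)|
      rw [shift_neg_shift]
      constructor
      · rintro ⟨⟨hc, he⟩, -⟩
        have he' : shift (-k) (Y ω) = Y ω := by
          conv_lhs => rw [he]
          exact shift_neg_shift k _
        refine ⟨⟨he ▸ hc, he'⟩, ?_⟩
        have := congrFun he' 0
        rw [shift_apply, zero_add] at this
        rwa [this]
      · rintro ⟨⟨hc, he⟩, -⟩
        have he' : shift k (Y ω) = Y ω := by
          conv_lhs => rw [← he]
          exact shift_shift_neg k _
        refine ⟨⟨he'.symm ▸ hc, he'.symm⟩, ?_⟩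
        have := congrFun he' 0
        rw [shift_apply, zero_add] at this
        rwa [this]
    · have := hE.measure_eq hY hY0 (hAm n) (hAk n) hC
      refine Eq.trans (congrArg μ (Set.ext fun ω => ?_)) this
      change (shift k (Y ω) ∈ C ∧ shift (-k) (shift k (Y ω)) ∈ A n) ∧ 1 < |Y ω k| ↔ _
      rw [shift_neg_shift]
      rfl
  have hind : ∀ (g : Ω → ℝ≥0∞) (j : Fin d → ℤ),
      ∫⁻ ω, g ω * exIndGT 1 j (Y ω) ∂μ = ∫⁻ ω in {ω | 1 < |Y ω j|}, g ω ∂μ := by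
    intro g j
    rw [← lintegral_indicator (hU j)]
    congr 1 with ω
    by_cases hω : 1 < |Y ω j| <;> simp [exIndGT, hω]
  rw [hind, hind, ← lintegral_map hh hYk, ← lintegral_map hh hY, hmain]

/-- A random element `Y` of `ℝ₀^{ℤ^d}` is exceedance-stationary if and only
if it satisfies the tail-process identity. In particular, tail processes of stationary random
fields are exceedance-stationary. -/
theorem exceedanceStationary_iff_tailIdentity
    {Ω : Type*} [MeasurableSpace Ω] (μ : Measure Ω) [IsProbabilityMeasure μ]
    (Y : Ω → RField d) (hY : Measurable Y) (hY0 : ∀ᵐ ω ∂μ, 1 < |Y ω 0|) :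
    ExcStationary μ Y ↔ TailIdentity μ Y := by
  exact ⟨fun h => h.tailIdentity hY hY0, fun h => h.excStationary hY⟩
end
end

section
/- Campbell theorem for the tail process: Let X = (X_i)_{i∈ℤ^d} be a stationary random field admitting a tail process Y, let f : [0,1]^d × ℝ^{ℤ^d} → [0,∞) be measurable, bounded and continuous (with ℝ^{ℤ^d} carrying the product topology), and let (c_n)_{n∈ℕ} be positive reals with c_n → ∞ and n^d P(|X_0| > c_n) → τ ∈ (0,∞). Then, as n → ∞, E[Σ_{k∈{1,…,n}^d} f(k/n, θ_k X / c_n) 1{|X_k| > c_n}] → τ ∫_{[0,1]^d} E[f(t, Y)] dt. -/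
open MeasureTheory ENNReal Filter ProbabilityTheory

noncomputable section

variable {d : ℕ}

/-- `X` is a stationary random field: all shifts of `X` have the same law. -/
def FieldStationary {Ω : Type*} [MeasurableSpace Ω] (μ : Measure Ω) (X : Ω → RField d) : Prop :=
  ∀ k : Fin d → ℤ, Measure.map (fun ω => shift k (X ω)) μ = Measure.map X μ

/-- `Y` is the tail process of `X`: `P(|Y_0| > 1) = 1`, and for every `m` the conditional law of
`(u⁻¹ X_i)_{i ∈ {−m,…,m}^d}` given `|X_0| > u` converges weakly to the law of
`(Y_i)_{i ∈ {−m,…,m}^d}` as `u → ∞`; weak convergence is phrased via bounded continuous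
test functions depending only on the coordinates in the cube `{−m,…,m}^d`. -/
def IsTailProcess {Ω : Type*} [MeasurableSpace Ω] (μ : Measure Ω)
    (X Y : Ω → RField d) : Prop :=
  (∀ᵐ ω ∂μ, 1 < |Y ω 0|) ∧
  ∀ m : ℕ, ∀ g : RField d → ℝ, Continuous g → (∃ Cg : ℝ, ∀ x, |g x| ≤ Cg) →
    (∀ x y : RField d, (∀ i : Fin d → ℤ, (∀ j, |i j| ≤ (m : ℤ)) → x i = y i) → g x = g y) →
    Tendsto (fun u : ℝ =>
        ∫ ω, g (u⁻¹ • X ω) ∂(ProbabilityTheory.cond μ {ω | u < |X ω 0|}))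
      atTop (nhds (∫ ω, g (Y ω) ∂μ))

open Topology

/-- Weak convergence in a countable power of `ℝ` follows from convergence of the integrals of
bounded continuous functions of finitely many coordinates. -/
theorem tendsto_probabilityMeasure_of_dependsOn {ι γ : Type*} [Countable ι] {l : Filter γ}
    [l.IsCountablyGenerated] {νs : γ → ProbabilityMeasure (ι → ℝ)}
    {ν : ProbabilityMeasure (ι → ℝ)}
    (h : ∀ g : (ι → ℝ) → ℝ, Continuous g → (∃ C : ℝ, ∀ x, |g x| ≤ C) →
      (∃ K : Finset ι, DependsOn g (K : Set ι)) →
      Tendsto (fun i => ∫ x, g x ∂(νs i : Measure (ι → ℝ))) l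
        (𝓝 (∫ x, g x ∂(ν : Measure (ι → ℝ))))) :
    Tendsto νs l (𝓝 ν) := by
  classical
  have := Encodable.ofCountable ι
  let : PseudoEMetricSpace (ι → ℝ) := PiCountable.pseudoEMetricSpace
  rw [tendsto_iff_forall_lipschitz_integral_tendsto]
  rintro f ⟨C, hC⟩ ⟨M, hM⟩
  have hfc : Continuous f := hM.continuous
  have hfb : ∀ x, |f x| ≤ |f 0| + C := fun x => by
    have h1 := hC x 0
    rw [Real.dist_eq] at h1
    have h2 := abs_sub_abs_le_abs_sub (f x) (f 0)
    linarith
  rw [Metric.tendsto_nhds]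
  intro ε hε
  obtain ⟨K, hK⟩ : ∃ K : Finset ι,
      ∑' i : {j // j ∉ K}, (2⁻¹ : ℝ≥0∞) ^ Encodable.encode (i : ι)
        < ENNReal.ofReal (ε / 4 / (M + 1)) :=
    ((tendsto_order.1 <| ENNReal.tendsto_tsum_compl_atTop_zero
      (tsum_geometric_encode_lt_top ENNReal.one_half_lt_one).ne).2 _
        (ENNReal.ofReal_pos.2 (by positivity))).exists
  let p : (ι → ℝ) → (ι → ℝ) := fun x i => if i ∈ K then x i else 0
  have hp : Continuous p := continuous_pi fun i => by
    by_cases hi : i ∈ K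
    · simpa [p, hi] using continuous_apply i
    · simpa [p, hi] using continuous_const
  have hclose : ∀ x, |f (p x) - f x| ≤ ε / 4 := by
    intro x
    have h1 : edist (p x) x ≤ ENNReal.ofReal (ε / 4 / (M + 1)) := by
      calc
        edist (p x) x = ∑' i : ι, min (2⁻¹ ^ Encodable.encode i) (edist (p x i) (x i)) := rfl
        _ = ∑ i ∈ K, min (2⁻¹ ^ Encodable.encode i) (edist (p x i) (x i)) +
              ∑' i : ↑(K : Set ι)ᶜ, min (2⁻¹ ^ Encodable.encode (i : ι)) (edist (p x i) (x i)) :=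
          (ENNReal.sum_add_tsum_compl ..).symm
        _ ≤ 0 + ∑' i : ↑(K : Set ι)ᶜ, 2⁻¹ ^ Encodable.encode (i : ι) := by
          gcongr
          · refine (Finset.sum_eq_zero fun i hi => ?_).le
            simp [p, hi]
          · apply min_le_left
        _ ≤ _ := by rw [zero_add]; exact hK.le
    have h2 := (hM (p x) x).trans (mul_le_mul_right h1 _)
    rw [edist_dist, Real.dist_eq, ← ENNReal.ofReal_coe_nnreal,
      ← ENNReal.ofReal_mul M.coe_nonneg, ENNReal.ofReal_le_ofReal_iff (by positivity)] at h2
    refine h2.trans ?_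
    rw [mul_div_assoc', div_le_iff₀ (by positivity)]
    nlinarith [M.coe_nonneg]
  have hint : ∀ ρ : ProbabilityMeasure (ι → ℝ),
      |∫ x, f (p x) ∂(ρ : Measure (ι → ℝ)) - ∫ x, f x ∂(ρ : Measure (ι → ℝ))| ≤ ε / 4 := by
    intro ρ
    rw [← integral_sub]
    · have := norm_integral_le_of_norm_le_const (μ := (ρ : Measure (ι → ℝ)))
        (f := fun x => f (p x) - f x) (Eventually.of_forall hclose)
      simpa using this
    · exact Integrable.of_bound (hfc.comp hp).aestronglyMeasurable _
        (Eventually.of_forall fun x => hfb (p x))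
    · exact Integrable.of_bound hfc.aestronglyMeasurable _ (Eventually.of_forall hfb)
  have hlim := h (fun x => f (p x)) (hfc.comp hp) ⟨_, fun x => hfb (p x)⟩ ⟨K, fun x y hxy => by
    have : p x = p y := by
      ext i
      by_cases hi : i ∈ K
      · simpa [p, hi] using hxy i hi
      · simp [p, hi]
    simp only [this]⟩
  filter_upwards [Metric.tendsto_nhds.1 hlim (ε / 4) (by positivity)] with i hi
  have h1 := hint (νs i)
  have h2 := hint ν
  rw [Real.dist_eq] at hi ⊢
  rw [abs_le] at h1 h2
  rw [abs_lt] at hi ⊢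
  constructor <;> linarith [h1.1, h1.2, h2.1, h2.2, hi.1, hi.2]

/-- The point `k / n` of the grid of mesh `1 / n`. -/
def gridPoint (n : ℕ) (k : Fin d → ℤ) : Fin d → ℝ := fun j => (k j : ℝ) / (n : ℝ)

theorem gridPoint_injective {n : ℕ} (hn : n ≠ 0) :
    Function.Injective (gridPoint (d := d) n) := by
  intro k l h
  ext j
  have := congrFun h j
  have hn' : (n : ℝ) ≠ 0 := by exact_mod_cast hn
  simp only [gridPoint] at this
  field_simp at this
  exact_mod_cast this

theorem gridPoint_mem_Icc {n : ℕ} {k : Fin d → ℤ}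
    (hk : k ∈ Finset.Icc (1 : Fin d → ℤ) (fun _ => (n : ℤ))) :
    gridPoint n k ∈ Set.Icc (0 : Fin d → ℝ) 1 := by
  rw [Finset.mem_Icc] at hk
  refine ⟨fun j => ?_, fun j => ?_⟩
  · have h1 : (1 : ℤ) ≤ k j := hk.1 j
    have h2 : (0 : ℝ) ≤ k j := by exact_mod_cast (by omega : (0 : ℤ) ≤ k j)
    simp only [gridPoint, Pi.zero_apply]
    positivity
  · have h2 : (k j : ℝ) ≤ n := by exact_mod_cast hk.2 j
    exact div_le_one_of_le₀ h2 (Nat.cast_nonneg n)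

theorem card_Icc_one_const (n : ℕ) :
    (Finset.Icc (1 : Fin d → ℤ) (fun _ => (n : ℤ))).card = n ^ d := by
  simp [Pi.card_Icc]

open BoxIntegral.unitPartition Pointwise in
theorem tendsto_sum_gridPoint_div_pow {F : (Fin d → ℝ) → ℝ} (hF : Continuous F) :
    Tendsto (fun n : ℕ =>
        (∑ k ∈ Finset.Icc (1 : Fin d → ℤ) (fun _ => (n : ℤ)), F (gridPoint n k)) / (n : ℝ) ^ d)
      atTop (𝓝 (∫ t in Set.Icc (0 : Fin d → ℝ) 1, F t)) := by
  classical
  let s : Set (Fin d → ℝ) := Set.pi Set.univ fun _ => Set.Ioc (0 : ℝ) 1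
  have hs : s =ᵐ[volume] Set.Icc (0 : Fin d → ℝ) 1 := Measure.univ_pi_Ioc_ae_eq_Icc
  have hsb : Bornology.IsBounded s := by
    refine (Metric.isBounded_Icc (0 : Fin d → ℝ) 1).subset fun x hx => ⟨?_, ?_⟩
    · exact fun j => (hx j trivial).1.le
    · exact fun j => (hx j trivial).2
  have hsc : Convex ℝ s := convex_pi fun _ _ => convex_Ioc 0 1
  have h := tendsto_tsum_div_pow_atTop_integral s F hF hsb
    (MeasurableSet.univ_pi fun _ => measurableSet_Ioc) (hsc.addHaar_frontier _)
  rw [setIntegral_congr_set hs] at h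
  refine h.congr' ?_
  filter_upwards [eventually_ge_atTop 1] with n hn
  have hn0 : n ≠ 0 := by omega
  have : NeZero n := ⟨hn0⟩
  have hnpos : (0 : ℝ) < n := by exact_mod_cast hn
  rw [Fintype.card_fin]
  congr 1
  have hset : s ∩ (n : ℝ)⁻¹ • (Submodule.span ℤ (Set.range (Pi.basisFun ℝ (Fin d))) :
        Set (Fin d → ℝ))
      = ((Finset.Icc (1 : Fin d → ℤ) (fun _ => (n : ℤ))).image (gridPoint n) : Finset _) := by
    ext x
    rw [Finset.coe_image, Finset.coe_Icc]
    constructor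
    · rintro ⟨hx, hx'⟩
      choose k hk using (mem_smul_span_iff (n := n)).1 hx'
      have hk' : ∀ i, (k i : ℝ) = n * x i := hk
      refine ⟨k, ⟨fun i => ?_, fun i => ?_⟩, ?_⟩
      · have : (0 : ℝ) < k i := by
          rw [hk']; exact mul_pos hnpos (hx i trivial).1
        have : 0 < k i := by exact_mod_cast this
        exact this
      · have : (k i : ℝ) ≤ n := by
          rw [hk']; exact mul_le_of_le_one_right hnpos.le (hx i trivial).2
        exact_mod_cast this
      · ext i
        simp only [gridPoint, hk']
        field_simp
    · rintro ⟨k, ⟨hk1, hk2⟩, rfl⟩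
      refine ⟨fun i _ => ⟨?_, ?_⟩, (mem_smul_span_iff (n := n)).2 fun i => ⟨k i, ?_⟩⟩
      · have : (1 : ℤ) ≤ k i := hk1 i
        have : (0 : ℝ) < k i := by exact_mod_cast (by omega : 0 < k i)
        simp only [gridPoint]
        positivity
      · have : (k i : ℝ) ≤ n := by exact_mod_cast hk2 i
        exact div_le_one_of_le₀ this hnpos.le
      · simp only [gridPoint, eq_intCast]
        field_simp
  have hts := Finset.tsum_subtype'
    ((Finset.Icc (1 : Fin d → ℤ) (fun _ => (n : ℤ))).image (gridPoint n)) F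
  rw [← hset, Finset.sum_image fun _ _ _ _ e => gridPoint_injective hn0 e] at hts
  exact hts

/-- The uniform distribution on the grid `{1 / n, …, n / n}^d`. -/
def gridMeasure (d n : ℕ) : Measure (Fin d → ℝ) :=
  ((n : ℝ≥0∞) ^ d)⁻¹ •
    ∑ k ∈ Finset.Icc (1 : Fin d → ℤ) (fun _ => (n : ℤ)), Measure.dirac (gridPoint n k)

theorem isProbabilityMeasure_gridMeasure {n : ℕ} (hn : n ≠ 0) :
    IsProbabilityMeasure (gridMeasure d n) := by
  constructor
  simp only [gridMeasure, Measure.smul_apply, Measure.finsetSum_apply, measure_univ,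
    Finset.sum_const, card_Icc_one_const, smul_eq_mul, nsmul_eq_mul, mul_one, Nat.cast_pow]
  exact ENNReal.inv_mul_cancel (by simp [hn]) (by simp)

theorem integral_gridMeasure (n : ℕ) (F : (Fin d → ℝ) → ℝ) :
    ∫ t, F t ∂gridMeasure d n =
      (∑ k ∈ Finset.Icc (1 : Fin d → ℤ) (fun _ => (n : ℤ)), F (gridPoint n k)) / (n : ℝ) ^ d := by
  rw [gridMeasure, integral_smul_measure, integral_finsetSum_measure]
  · simp [div_eq_inv_mul]
  · intro k _
    exact integrable_dirac (by simp)

/-- By stationarity, the contribution of an exceedance at `k` is that of one at the origin. -/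
theorem integral_indicator_shift_eq {Ω : Type*} [MeasurableSpace Ω] {μ : Measure Ω}
    {X : Ω → RField d} (hX : Measurable X) (hstat : FieldStationary μ X) (k : Fin d → ℤ)
    (u : ℝ) {G : RField d → ℝ} (hG : Measurable G) :
    ∫ ω, Set.indicator {ω' : Ω | u < |X ω' k|} (fun ω' => G (shift k (X ω'))) ω ∂μ
      = ∫ ω in {ω' : Ω | u < |X ω' 0|}, G (X ω) ∂μ := by
  have hA : MeasurableSet {x : RField d | u < |x 0|} :=
    measurableSet_lt measurable_const (measurable_pi_apply 0).abs
  have hm : Measurable (Set.indicator {x : RField d | u < |x 0|} G) := hG.indicator hA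
  have hsh : Measurable fun ω => shift k (X ω) :=
    measurable_pi_lambda _ fun i => (measurable_pi_apply (i + k)).comp hX
  have hA' : MeasurableSet {ω' : Ω | u < |X ω' 0|} := hX hA
  rw [← integral_indicator hA']
  have h1 := integral_map (μ := μ) hX.aemeasurable hm.aestronglyMeasurable
  have h2 := integral_map (μ := μ) hsh.aemeasurable hm.aestronglyMeasurable
  rw [hstat k, h1] at h2
  refine (h2.trans ?_).symm
  refine integral_congr_ae (Eventually.of_forall fun ω => ?_)
  simp [Set.indicator, shift]

/-- **Campbell theorem for the tail process.**
If `X` is stationary with tail process `Y`, `f : [0,1]^d × ℝ^{ℤ^d} → [0,∞)` is measurable,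
bounded and continuous, and `c_n → ∞` with `n^d P(|X_0| > c_n) → τ ∈ (0,∞)`, then
`E[Σ_{k∈{1,…,n}^d} f(k/n, θ_k X / c_n) 1{|X_k| > c_n}] → τ ∫_{[0,1]^d} E[f(t, Y)] dt`. -/
theorem campbell_tail_process
    {Ω : Type*} [MeasurableSpace Ω] (μ : Measure Ω) [IsProbabilityMeasure μ]
    (X Y : Ω → RField d) (hX : Measurable X) (hYm : Measurable Y)
    (hstat : FieldStationary μ X) (htail : IsTailProcess μ X Y)
    (f : (Fin d → ℝ) → RField d → ℝ)
    (hfmeas : Measurable (Function.uncurry f))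
    (hfcont : ContinuousOn (Function.uncurry f) ((Set.Icc (0 : Fin d → ℝ) 1) ×ˢ Set.univ))
    (hfbdd : ∃ Cf : ℝ, ∀ t ∈ Set.Icc (0 : Fin d → ℝ) 1, ∀ x : RField d, |f t x| ≤ Cf)
    (hfnonneg : ∀ t ∈ Set.Icc (0 : Fin d → ℝ) 1, ∀ x : RField d, 0 ≤ f t x)
    (c : ℕ → ℝ) (hcpos : ∀ n, 0 < c n) (hc : Tendsto c atTop atTop)
    (τ : ℝ) (hτ : 0 < τ)
    (hτlim : Tendsto (fun n : ℕ => (n : ℝ) ^ d * (μ {ω | c n < |X ω 0|}).toReal)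
      atTop (nhds τ)) :
    Tendsto (fun n : ℕ =>
        ∫ ω, ∑ k ∈ Finset.Icc (1 : Fin d → ℤ) (fun _ => (n : ℤ)),
          Set.indicator {ω' : Ω | c n < |X ω' k|}
            (fun ω' => f (fun j => (k j : ℝ) / (n : ℝ)) ((c n)⁻¹ • shift k (X ω'))) ω ∂μ)
      atTop
      (nhds (τ * ∫ t in Set.Icc (0 : Fin d → ℝ) 1, (∫ ω, f t (Y ω) ∂μ) ∂volume)) := by
  obtain ⟨Cf, hCf⟩ := hfbdd
  have hne : ∀ᶠ n in atTop, n ≠ 0 ∧ μ {ω | c n < |X ω 0|} ≠ 0 := by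
    filter_upwards [hτlim.eventually_const_lt hτ, eventually_ne_atTop 0] with n hn hn0
    refine ⟨hn0, fun h => ?_⟩
    simp [h] at hn
  obtain ⟨N, hN⟩ := eventually_atTop.1 hne
  have hA : ∀ u, MeasurableSet {ω | u < |X ω 0|} := fun u =>
    measurableSet_lt measurable_const ((measurable_pi_apply 0).comp hX).abs
  have hXc : ∀ u : ℝ, Measurable fun ω => u • X ω := fun u => hX.const_smul u
  -- the clamped integrand, continuous on the whole space
  let q : (Fin d → ℝ) → (Fin d → ℝ) := fun t => (t ⊓ 1) ⊔ 0
  have hq : Continuous q := continuous_pi fun j =>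
    ((continuous_apply j).min continuous_const).max continuous_const
  have hqmem : ∀ t, q t ∈ Set.Icc (0 : Fin d → ℝ) 1 := fun t =>
    ⟨le_sup_right, sup_le inf_le_right zero_le_one⟩
  have hqid : ∀ t ∈ Set.Icc (0 : Fin d → ℝ) 1, q t = t := fun t ht => by
    simp only [q]
    rw [inf_eq_left.2 ht.2, sup_eq_left.2 ht.1]
  have hFc : Continuous fun z : (Fin d → ℝ) × RField d => f (q z.1) z.2 :=
    hfcont.comp_continuous (f := fun z : (Fin d → ℝ) × RField d => (q z.1, z.2))
      (by fun_prop) fun z => ⟨hqmem z.1, trivial⟩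
  let F : BoundedContinuousFunction ((Fin d → ℝ) × RField d) ℝ :=
    BoundedContinuousFunction.ofNormedAddCommGroup _ hFc Cf fun z => hCf _ (hqmem z.1) z.2
  -- the distributions of the position and of the rescaled conditioned field
  let lam : ℕ → ProbabilityMeasure (Fin d → ℝ) := fun n =>
    ⟨gridMeasure d (n + N), isProbabilityMeasure_gridMeasure (hN _ (Nat.le_add_left _ _)).1⟩
  have hvol : IsProbabilityMeasure (volume.restrict (Set.Icc (0 : Fin d → ℝ) 1)) := by
    constructor
    simp [Real.volume_Icc_pi]
  let lam' : ProbabilityMeasure (Fin d → ℝ) := ⟨_, hvol⟩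
  let P : ℕ → Measure Ω := fun n => ProbabilityTheory.cond μ {ω | c n < |X ω 0|}
  have hP : ∀ n, IsProbabilityMeasure (P (n + N)) := fun n =>
    cond_isProbabilityMeasure (hN _ (Nat.le_add_left _ _)).2
  let nu : ℕ → ProbabilityMeasure (RField d) := fun n =>
    ⟨(P (n + N)).map fun ω => (c (n + N))⁻¹ • X ω,
      have := hP n
      Measure.isProbabilityMeasure_map (hXc _).aemeasurable⟩
  let nu' : ProbabilityMeasure (RField d) :=
    ⟨μ.map Y, Measure.isProbabilityMeasure_map hYm.aemeasurable⟩
  have hlam : Tendsto lam atTop (𝓝 lam') := by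
    rw [ProbabilityMeasure.tendsto_iff_forall_integral_tendsto]
    intro g
    have := (tendsto_add_atTop_iff_nat N).2 (tendsto_sum_gridPoint_div_pow g.continuous)
    simpa only [← integral_gridMeasure] using! this
  have hnu : Tendsto nu atTop (𝓝 nu') := by
    refine tendsto_probabilityMeasure_of_dependsOn fun g hgc hgb ⟨K, hK⟩ => ?_
    obtain ⟨m, hm⟩ : ∃ m : ℕ, ∀ i ∈ K, ∀ j, |i j| ≤ (m : ℤ) := by
      refine ⟨K.sup fun i => Finset.univ.sup fun j => (i j).natAbs, fun i hi j => ?_⟩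
      rw [Int.abs_eq_natAbs]
      have h1 := Finset.le_sup (f := fun i : Fin d → ℤ => Finset.univ.sup fun j => (i j).natAbs) hi
      have h2 := Finset.le_sup (f := fun j => (i j).natAbs) (Finset.mem_univ j)
      exact_mod_cast h2.trans h1
    have h := htail.2 m g hgc hgb fun x y hxy => hK fun i hi => hxy i (hm i hi)
    have h := (tendsto_add_atTop_iff_nat N).2 (h.comp hc)
    have e1 : ∫ x, g x ∂(nu' : Measure (RField d)) = ∫ ω, g (Y ω) ∂μ :=
      integral_map hYm.aemeasurable hgc.aestronglyMeasurable
    have e2 : ∀ n, ∫ x, g x ∂(nu n : Measure (RField d))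
        = ∫ ω, g ((c (n + N))⁻¹ • X ω) ∂P (n + N) := fun n =>
      integral_map (hXc _).aemeasurable hgc.aestronglyMeasurable
    rw [e1]
    simp only [e2]
    exact h
  have hprod : Tendsto (fun n => (lam n).prod (nu n)) atTop (𝓝 (lam'.prod nu')) :=
    (ProbabilityMeasure.continuous_prod.tendsto (lam', nu')).comp (hlam.prodMk_nhds hnu)
  have hlim := (ProbabilityMeasure.tendsto_iff_forall_integral_tendsto.1 hprod) F
  have hFint : ∀ ρ : ProbabilityMeasure ((Fin d → ℝ) × RField d),
      Integrable (fun z => f (q z.1) z.2) (ρ : Measure ((Fin d → ℝ) × RField d)) := fun ρ =>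
    Integrable.of_bound hFc.aestronglyMeasurable Cf
      (Eventually.of_forall fun z => hCf _ (hqmem z.1) z.2)
  have hsec : ∀ t, Continuous fun x => f (q t) x := fun t =>
    hFc.comp (Continuous.prodMk_right t)
  have elim : ∫ z, F z ∂((lam'.prod nu' : ProbabilityMeasure _) : Measure _)
      = ∫ t in Set.Icc (0 : Fin d → ℝ) 1, (∫ ω, f t (Y ω) ∂μ) ∂volume := by
    refine (integral_prod _ (hFint (lam'.prod nu'))).trans ?_
    refine setIntegral_congr_fun measurableSet_Icc fun t ht => ?_
    simp only [hqid t ht]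
    refine integral_map hYm.aemeasurable ?_
    simpa only [hqid t ht] using (hsec t).aestronglyMeasurable
  rw [elim] at hlim
  rw [← tendsto_add_atTop_iff_nat N]
  refine (((tendsto_add_atTop_iff_nat N).2 hτlim).mul hlim).congr fun n => ?_
  obtain ⟨hn0, hμ0⟩ := hN (n + N) (Nat.le_add_left _ _)
  have eprod : ∫ z, F z ∂(((lam n).prod (nu n) : ProbabilityMeasure _) : Measure _)
      = (∑ k ∈ Finset.Icc (1 : Fin d → ℤ) (fun _ => ((n + N : ℕ) : ℤ)),
          ∫ ω, f (gridPoint (n + N) k) ((c (n + N))⁻¹ • X ω) ∂P (n + N))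
            / ((n + N : ℕ) : ℝ) ^ d := by
    refine (integral_prod _ (hFint ((lam n).prod (nu n)))).trans ?_
    refine (integral_gridMeasure (n + N) _).trans ?_
    congr 1
    refine Finset.sum_congr rfl fun k hk => ?_
    simp only [hqid _ (gridPoint_mem_Icc hk)]
    refine integral_map (hXc _).aemeasurable ?_
    simpa only [hqid _ (gridPoint_mem_Icc hk)] using
      (hsec (gridPoint (n + N) k)).aestronglyMeasurable
  rw [eprod]
  generalize n + N = m at *
  have hmd : ((m : ℝ) ^ d) ≠ 0 := by positivity
  have hμr : (μ {ω | c m < |X ω 0|}).toReal ≠ 0 :=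
    ENNReal.toReal_ne_zero.2 ⟨hμ0, measure_ne_top _ _⟩
  have hfm : ∀ t, Measurable (f t) := fun t => hfmeas.comp measurable_prodMk_left
  have hsh : ∀ k, Measurable fun ω => (c m)⁻¹ • shift k (X ω) := fun k =>
    measurable_pi_lambda _ fun i => ((measurable_pi_apply (i + k)).comp hX).const_mul _
  rw [integral_finsetSum]
  · rw [mul_comm, div_mul_eq_mul_div, mul_comm ((m : ℝ) ^ d), ← mul_assoc,
      mul_div_cancel_right₀ _ hmd, Finset.sum_mul]
    refine Finset.sum_congr rfl fun k hk => ?_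
    have h := integral_indicator_shift_eq hX hstat k (c m)
      (G := fun x => f (gridPoint m k) ((c m)⁻¹ • x)) ((hfm _).comp (measurable_const_smul _))
    refine Eq.trans ?_ h.symm
    simp only [P, ProbabilityTheory.cond, integral_smul_measure, ENNReal.toReal_inv, smul_eq_mul]
    field_simp
  · intro k hk
    refine Integrable.indicator ?_
      (measurableSet_lt measurable_const ((measurable_pi_apply k).comp hX).abs)
    refine Integrable.of_bound ((hfm _).comp (hsh k)).aestronglyMeasurable Cf
      (Eventually.of_forall fun ω => hCf _ (gridPoint_mem_Icc hk) _)
end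
end
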